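/- arXiv:2207.08956 — 4 statements merged into one kernel-verified Lean document; each statement's English description precedes it below -/
import Mathlib

section
/- For any r ∈ [0,1], any p > 0, and any c > 0, the inequality r/(p + c) ≤ (1/(2c))·log(1 + 2c·r/p) holds. More generally, for the indicator version: for b ∈ {0,1}, r·b/(p + c) ≤ (1/(2c))·log(1 + 2c·r·b/p). -/
/-- the IX inequality `r/(p+c) ≤ (1/(2c))·log(1 + 2c·r/p)` for `r ∈ [0,1]`,
`p > 0`, `c > 0`, together with its indicator version for `b ∈ {0,1}`. -/
theorem ix_inequality
    (r p c : ℝ) (hr : r ∈ Set.Icc (0 : ℝ) 1) (hp : 0 < p) (hc : 0 < c) :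
    r / (p + c) ≤ (1 / (2 * c)) * Real.log (1 + 2 * c * r / p) ∧
      ∀ b : ℝ, b = 0 ∨ b = 1 →
        r * b / (p + c) ≤ (1 / (2 * c)) * Real.log (1 + 2 * c * (r * b) / p) := by
  obtain ⟨h0, h1⟩ := hr
  have main : r / (p + c) ≤ (1 / (2 * c)) * Real.log (1 + 2 * c * r / p) := by
    have hcr : 0 ≤ c * r := mul_nonneg hc.le h0
    have hx : 0 ≤ 2 * c * r / p := by positivity
    have hlog := Real.le_log_one_add_of_nonneg hx
    have e : 2 * (2 * c * r / p) / (2 * c * r / p + 2) = 2 * c * (r / (p + c * r)) := by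
      have : p + c * r ≠ 0 := by positivity
      have : 2 * c * r / p + 2 ≠ 0 := by positivity
      field_simp
      ring
    rw [e] at hlog
    have h2 : r / (p + c) ≤ r / (p + c * r) := by
      apply div_le_div_of_nonneg_left h0 (by positivity)
      nlinarith
    rw [one_div, inv_mul_eq_div, le_div_iff₀ (by positivity)]
    nlinarith [mul_le_mul_of_nonneg_left h2 hc.le]
  refine ⟨main, ?_⟩
  rintro b (rfl | rfl)
  · simp
  · simpa only [mul_one] using main
end

section
/- Fix any realized sequence of behavior actions a^B_1, …, a^B_n ∈ 𝒜. With γ = η/2, define r̃_t(a) = r_t(a)·1{a^B_t = a}/(π_B(a) + γ) and r̂_t(a) = r_t(a)·1{a^B_t = a}/π_B(a), and let π_t be the exponential-weights policy built from r̃ with learning rate η > 0. Then for any comparator policy π* ∈ Δ_𝒜: Σ_{t=1}^n Σ_{a∈𝒜} π*(a)·r̃_t(a) ≤ (log K)/η + Σ_{t=1}^n Σ_{a∈𝒜} π_t(a)·r̂_t(a). -/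
/-- for a fixed realized sequence of behavior actions, with `γ = η/2`,
the IX estimates `r̃` and unbiased estimates `r̂` satisfy
`∑_t ∑_a π*(a)·r̃_t(a) ≤ (log K)/η + ∑_t ∑_a π_t(a)·r̂_t(a)`,
where `π_t` is the exponential-weights policy built from `r̃`. -/
theorem exp3_ix_deterministic_bound
    {𝒜 : Type*} [Fintype 𝒜] [Nonempty 𝒜] [DecidableEq 𝒜]
    (K : ℕ) (hK : K = Fintype.card 𝒜) (hK1 : 1 ≤ K)
    (n : ℕ) (r : ℕ → 𝒜 → ℝ) (hr : ∀ t a, r t a ∈ Set.Icc (0 : ℝ) 1)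
    (πB : 𝒜 → ℝ) (hπB_pos : ∀ a, 0 < πB a) (hπB_sum : ∑ a, πB a = 1)
    (aB : ℕ → 𝒜)
    (η : ℝ) (hη : 0 < η)
    (rtil : ℕ → 𝒜 → ℝ)
    (hrtil : ∀ t a, rtil t a = r t a * (if aB t = a then 1 else 0) / (πB a + η / 2))
    (rhat : ℕ → 𝒜 → ℝ)
    (hrhat : ∀ t a, rhat t a = r t a * (if aB t = a then 1 else 0) / πB a)
    (w : ℕ → 𝒜 → ℝ)
    (hw : ∀ t a, w t a = Real.exp (η * ∑ k ∈ Finset.range t, rtil k a))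
    (pol : ℕ → 𝒜 → ℝ)
    (hpol : ∀ t a, pol t a = w t a / ∑ a', w t a')
    (πstar : 𝒜 → ℝ) (hπstar_nonneg : ∀ a, 0 ≤ πstar a) (hπstar_sum : ∑ a, πstar a = 1) :
    ∑ t ∈ Finset.range n, ∑ a, πstar a * rtil t a ≤
      Real.log K / η + ∑ t ∈ Finset.range n, ∑ a, pol t a * rhat t a := by
  have key : ∀ t a, Real.exp (η * rtil t a) ≤ 1 + η * rhat t a := by
    intro t a
    have hp := hπB_pos a
    obtain ⟨h0, h1⟩ := hr t a
    rw [hrtil, hrhat]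
    by_cases h : aB t = a
    · simp only [h, if_true, mul_one]
      have hz : 0 ≤ η * (r t a / πB a) := by positivity
      have h2 := Real.le_log_one_add_of_nonneg hz
      rw [← Real.le_log_iff_exp_le (by positivity)]
      refine le_trans ?_ h2
      have e : 2 * (η * (r t a / πB a)) / (η * (r t a / πB a) + 2)
          = η * (r t a / (πB a + η * r t a / 2)) := by
        have h3 : 0 < πB a + η * r t a / 2 := by positivity
        have h4 : 0 < η * (r t a / πB a) + 2 := by positivity
        have h5 : η * (r t a / πB a) + 2 = 2 * (πB a + η * r t a / 2) / πB a := by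
          field_simp
          ring
        rw [h5]
        field_simp
      rw [e]
      have h6 : η * r t a ≤ η := by nlinarith
      gcongr
    · simp [h]
  have hWpos : ∀ t, 0 < ∑ a, w t a := fun t =>
    Finset.sum_pos (fun a _ => by rw [hw]; exact Real.exp_pos _) Finset.univ_nonempty
  have step : ∀ t, ∑ a, w (t+1) a ≤ (∑ a, w t a) * Real.exp (η * ∑ a, pol t a * rhat t a) := by
    intro t
    have h1 : ∑ a, w (t+1) a ≤ ∑ a, w t a * (1 + η * rhat t a) := by
      refine Finset.sum_le_sum fun a _ => ?_
      have e : w (t+1) a = w t a * Real.exp (η * rtil t a) := by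
        rw [hw, hw, Finset.sum_range_succ, mul_add, Real.exp_add]
      rw [e]
      exact mul_le_mul_of_nonneg_left (key t a) (by rw [hw]; positivity)
    have h2 : ∑ a, w t a * (1 + η * rhat t a)
        = (∑ a, w t a) * (1 + η * ∑ a, pol t a * rhat t a) := by
      rw [mul_add, mul_one, Finset.mul_sum, Finset.mul_sum, ← Finset.sum_add_distrib]
      refine Finset.sum_congr rfl fun a _ => ?_
      have := (hWpos t).ne'
      rw [hpol]
      field_simp
    rw [h2] at h1
    refine h1.trans (mul_le_mul_of_nonneg_left ?_ (hWpos t).le)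
    linarith [Real.add_one_le_exp (η * ∑ a, pol t a * rhat t a)]
  have tot : ∀ m, ∑ a, w m a ≤
      K * Real.exp (η * ∑ t ∈ Finset.range m, ∑ a, pol t a * rhat t a) := by
    intro m
    induction m with
    | zero => simp [hw, hK]
    | succ m ih =>
      rw [Finset.sum_range_succ, mul_add, Real.exp_add, ← mul_assoc]
      exact (step m).trans (mul_le_mul_of_nonneg_right ih (Real.exp_pos _).le)
  have hKpos : (0 : ℝ) < K := by exact_mod_cast hK1
  have each : ∀ a, ∑ t ∈ Finset.range n, rtil t a ≤
      Real.log K / η + ∑ t ∈ Finset.range n, ∑ a, pol t a * rhat t a := by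
    intro a
    have h1 : w n a ≤ ∑ a, w n a :=
      Finset.single_le_sum (f := fun a => w n a)
        (fun b _ => by rw [hw]; positivity) (Finset.mem_univ a)
    have h2 := h1.trans (tot n)
    rw [hw, ← Real.le_log_iff_exp_le (by positivity),
      Real.log_mul hKpos.ne' (Real.exp_pos _).ne', Real.log_exp] at h2
    refine le_of_mul_le_mul_left ?_ hη
    rw [mul_add, mul_div_cancel₀ _ hη.ne']
    exact h2
  rw [Finset.sum_comm]
  simp_rw [← Finset.mul_sum]
  calc _ ≤ ∑ a, πstar a * (Real.log K / η + ∑ t ∈ Finset.range n, ∑ a, pol t a * rhat t a) :=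
        Finset.sum_le_sum fun a _ => mul_le_mul_of_nonneg_left (each a) (hπstar_nonneg a)
    _ = _ := by rw [← Finset.sum_mul, hπstar_sum, one_mul]
end

section
/- Let p > 0, let p̂ ≥ 0 satisfy |p̂ − p| ≤ ε for some ε ≥ 0, let η > 0, set γ = ε + η/2, and let r ∈ [0,1], b ∈ {0,1}. Then r·b/(p̂ + γ) ≤ r·b/(p + η/2) ≤ (1/η)·log(1 + η·r·b/p). -/
/-- the key deterministic bound for Exp3-IX with an estimated behavior
policy: if `|p̂ − p| ≤ ε` and `γ = ε + η/2`, then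
`r·b/(p̂ + γ) ≤ r·b/(p + η/2) ≤ (1/η)·log(1 + η·r·b/p)`. -/
theorem ix_estimated_policy_bound
    (p : ℝ) (hp : 0 < p) (phat : ℝ) (hphat : 0 ≤ phat)
    (ε : ℝ) (hε : 0 ≤ ε) (hclose : |phat - p| ≤ ε)
    (η : ℝ) (hη : 0 < η) (γ : ℝ) (hγ : γ = ε + η / 2)
    (r : ℝ) (hr : r ∈ Set.Icc (0 : ℝ) 1) (b : ℝ) (hb : b = 0 ∨ b = 1) :
    r * b / (phat + γ) ≤ r * b / (p + η / 2) ∧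
      r * b / (p + η / 2) ≤ (1 / η) * Real.log (1 + η * (r * b) / p) := by
  obtain ⟨hr0, hr1⟩ := hr
  have h0 : 0 ≤ r * b := by rcases hb with rfl | rfl <;> simp [hr0]
  have h1 : r * b ≤ 1 := by rcases hb with rfl | rfl <;> simp [hr1]
  generalize r * b = s at h0 h1
  have hc := (abs_le.mp hclose).1
  constructor
  · apply div_le_div_of_nonneg_left h0 (by positivity)
    rw [hγ]; linarith
  · have hx : 0 ≤ η * s / p := by positivity
    have key := Real.le_log_one_add_of_nonneg hx
    have e : 2 * (η * s / p) / (η * s / p + 2) = η * (s / (p + η * s / 2)) := by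
      have : 0 < p + η * s / 2 := by positivity
      have : 0 < η * s / p + 2 := by positivity
      have : 0 < η * s + 2 * p := by positivity
      have : 0 < 2 * p + η * s := by positivity
      field_simp
      ring
    have h2 : s / (p + η / 2) ≤ s / (p + η * s / 2) := by
      apply div_le_div_of_nonneg_left h0 (by positivity)
      nlinarith
    rw [e] at key
    rw [one_div, inv_mul_eq_div, le_div_iff₀ hη]
    nlinarith
end

section
/- Let η > 0 and let r̂_1, …, r̂_n : 𝒜 → ℝ satisfy η·r̂_t(a) ≥ −1/2 for all t and a. Define the Prod policies π_t(a) = ∏_{k=1}^{t-1}(1 + η·r̂_k(a)) / Σ_{a'∈𝒜} ∏_{k=1}^{t-1}(1 + η·r̂_k(a')). Then for any comparator policy π* ∈ Δ_𝒜: Σ_{t=1}^n Σ_{a∈𝒜} (π*(a) − π_t(a))·r̂_t(a) ≤ (log K)/η + η·Σ_{t=1}^n Σ_{a∈𝒜} π*(a)·(r̂_t(a))². -/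
lemma prod_log_aux (z : ℝ) (hz : -(1 / 2) ≤ z) : z - z ^ 2 ≤ Real.log (1 + z) := by
  rcases le_total 0 z with h | h
  · refine le_trans ?_ (Real.le_log_one_add_of_nonneg h)
    rw [le_div_iff₀ (by linarith)]
    nlinarith [mul_nonneg h (mul_nonneg h h), mul_nonneg h h]
  · obtain ⟨u, rfl⟩ : ∃ u, z = -u := ⟨-z, by ring⟩
    have hu0 : 0 ≤ u := by linarith
    have hu1 : u ≤ 1 / 2 := by linarith
    have key := Real.abs_log_sub_add_sum_range_le (x := u)
      (by rw [abs_of_nonneg hu0]; linarith) 4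
    rw [abs_of_nonneg hu0] at key
    have k2 := (abs_le.1 key).1
    have h3 : u ^ (4 + 1) / (1 - u) ≤ 2 * u ^ 5 := by
      rw [div_le_iff₀ (by linarith)]
      have : 0 ≤ u ^ 5 := by positivity
      norm_num
      nlinarith
    simp only [Finset.sum_range_succ, Finset.sum_range_zero] at k2
    norm_num at k2 h3
    have h4 : u ^ 3 / 3 + u ^ 4 / 4 + 2 * u ^ 5 ≤ u ^ 2 / 2 := by
      have a2 : u ^ 2 ≤ 1 / 4 := by nlinarith
      have a3 : u ^ 3 ≤ 1 / 8 := by nlinarith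
      have : 0 ≤ u ^ 2 * (1 / 2 - u / 3 - u ^ 2 / 4 - 2 * u ^ 3) :=
        mul_nonneg (sq_nonneg u) (by linarith)
      nlinarith
    have e : (1 : ℝ) + -u = 1 - u := by ring
    rw [e]
    nlinarith

/-- the Prod regret bound. If `η·r̂_t(a) ≥ −1/2` for all `t, a`, then the
Prod policies satisfy
`∑_t ∑_a (π*(a) − π_t(a))·r̂_t(a) ≤ (log K)/η + η·∑_t ∑_a π*(a)·r̂_t(a)²`. -/
theorem prod_regret_bound
    {𝒜 : Type*} [Fintype 𝒜] [Nonempty 𝒜]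
    (K : ℕ) (hK : K = Fintype.card 𝒜) (hK1 : 1 ≤ K)
    (n : ℕ) (η : ℝ) (hη : 0 < η)
    (rhat : ℕ → 𝒜 → ℝ) (hrhat : ∀ t a, -(1 / 2) ≤ η * rhat t a)
    (pol : ℕ → 𝒜 → ℝ)
    (hpol : ∀ t a, pol t a =
      (∏ k ∈ Finset.range t, (1 + η * rhat k a)) /
        ∑ a', ∏ k ∈ Finset.range t, (1 + η * rhat k a'))
    (πstar : 𝒜 → ℝ) (hπstar_nonneg : ∀ a, 0 ≤ πstar a) (hπstar_sum : ∑ a, πstar a = 1) :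
    ∑ t ∈ Finset.range n, ∑ a, (πstar a - pol t a) * rhat t a ≤
      Real.log K / η + η * ∑ t ∈ Finset.range n, ∑ a, πstar a * (rhat t a) ^ 2 := by
  have hpos : ∀ t a, 0 < 1 + η * rhat t a := fun t a => by linarith [hrhat t a]
  have hw : ∀ t a, 0 < ∏ k ∈ Finset.range t, (1 + η * rhat k a) :=
    fun t a => Finset.prod_pos fun k _ => hpos k a
  have hW : ∀ t, 0 < ∑ a, ∏ k ∈ Finset.range t, (1 + η * rhat k a) :=
    fun t => Finset.sum_pos (fun a _ => hw t a) Finset.univ_nonempty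
  have upper : ∀ m, Real.log (∑ a, ∏ k ∈ Finset.range m, (1 + η * rhat k a)) ≤
      Real.log K + η * ∑ t ∈ Finset.range m, ∑ a, pol t a * rhat t a := by
    intro m
    induction m with
    | zero => simp [hK]
    | succ m ih =>
      have e : (∑ a, ∏ k ∈ Finset.range (m + 1), (1 + η * rhat k a)) =
          (∑ a, ∏ k ∈ Finset.range m, (1 + η * rhat k a)) *
            (1 + η * ∑ a, pol m a * rhat m a) := by
        have h1 : (∑ a, ∏ k ∈ Finset.range m, (1 + η * rhat k a)) *
            ∑ a, pol m a * rhat m a =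
            ∑ a, (∏ k ∈ Finset.range m, (1 + η * rhat k a)) * rhat m a := by
          rw [Finset.mul_sum]
          refine Finset.sum_congr rfl fun a _ => ?_
          rw [hpol]
          have := (hW m).ne'
          field_simp
        rw [mul_add, mul_one, mul_left_comm, h1, Finset.mul_sum, ← Finset.sum_add_distrib]
        refine Finset.sum_congr rfl fun a _ => ?_
        rw [Finset.prod_range_succ]
        ring
      have hq : 0 < 1 + η * ∑ a, pol m a * rhat m a := by
        have := hW (m + 1)
        rw [e] at this
        exact (mul_pos_iff_of_pos_left (hW m)).1 this
      rw [e, Real.log_mul (hW m).ne' hq.ne', Finset.sum_range_succ, mul_add]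
      have := Real.log_le_sub_one_of_pos hq
      linarith
  have lower : ∑ t ∈ Finset.range n, ∑ a, πstar a * (η * rhat t a - (η * rhat t a) ^ 2) ≤
      Real.log (∑ a, ∏ k ∈ Finset.range n, (1 + η * rhat k a)) := by
    rw [Finset.sum_comm]
    calc _ ≤ ∑ a, πstar a * Real.log (∑ a, ∏ k ∈ Finset.range n, (1 + η * rhat k a)) := by
          refine Finset.sum_le_sum fun a _ => ?_
          rw [← Finset.mul_sum]
          refine mul_le_mul_of_nonneg_left ?_ (hπstar_nonneg a)
          refine le_trans (Finset.sum_le_sum fun t _ => prod_log_aux _ (hrhat t a)) ?_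
          rw [← Real.log_prod (fun t _ => (hpos t a).ne')]
          exact Real.log_le_log (hw n a) (Finset.single_le_sum
            (f := fun a => ∏ k ∈ Finset.range n, (1 + η * rhat k a))
            (fun b _ => (hw n b).le) (Finset.mem_univ a))
      _ = _ := by rw [← Finset.sum_mul, hπstar_sum, one_mul]
  have hl : ∑ t ∈ Finset.range n, ∑ a, πstar a * (η * rhat t a - (η * rhat t a) ^ 2) =
      η * ∑ t ∈ Finset.range n, ∑ a, πstar a * rhat t a -
      η * (η * ∑ t ∈ Finset.range n, ∑ a, πstar a * (rhat t a) ^ 2) := by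
    simp only [Finset.mul_sum, ← Finset.sum_sub_distrib]
    refine Finset.sum_congr rfl fun t _ => Finset.sum_congr rfl fun a _ => ?_
    ring
  have hr : ∑ t ∈ Finset.range n, ∑ a, (πstar a - pol t a) * rhat t a =
      ∑ t ∈ Finset.range n, ∑ a, πstar a * rhat t a -
      ∑ t ∈ Finset.range n, ∑ a, pol t a * rhat t a := by
    simp only [sub_mul, Finset.sum_sub_distrib]
  have hfin := lower.trans (upper n)
  rw [hl] at hfin
  rw [hr, ← sub_le_iff_le_add, le_div_iff₀ hη]
  linarith
end
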